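/- arXiv:2504.10425 — 5 statements merged into one kernel-verified Lean document; each statement's English description precedes it below -/
import Mathlib

section
/- There exists an absolute constant c1 > 0 such that for every integer d ≥ 2, liminf_{n→∞} E_{2,d}(n)/n ≥ 1/2 + c1/√d. (This is the lower-bound half of the theorem γ_{2,d} = 1/2 + Θ(1/√d).) -/
/-- The length of the longest common subsequence of the `d` strings `X 0, …, X (d-1)`
over the alphabet `Fin k`. -/
noncomputable def lcsLen {k : ℕ} (d : ℕ) (X : Fin d → List (Fin k)) : ℕ :=
  sSup {m : ℕ | ∃ w : List (Fin k), w.length = m ∧ ∀ i : Fin d, w.Sublist (X i)}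

/-- `expLCS k d n` is the expected LCS length of `d` independent uniformly random strings
of length `n` over an alphabet of size `k`. -/
noncomputable def expLCS (k d n : ℕ) : ℝ :=
  (∑ X : Fin d → Fin n → Fin k, (lcsLen d (fun i => List.ofFn (X i)) : ℝ)) /
    (Fintype.card (Fin d → Fin n → Fin k) : ℝ)

open Finset

/-- The finite set of binary strings of length `n`. -/
def binaryStrings (n : ℕ) : Finset (List (Fin 2)) :=
  (Finset.univ : Finset (Fin n → Fin 2)).map ⟨List.ofFn, List.ofFn_injective⟩

lemma mem_binaryStrings {n : ℕ} {x : List (Fin 2)} :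
    x ∈ binaryStrings n ↔ x.length = n := by
  simp only [binaryStrings, mem_map, mem_univ, true_and, Function.Embedding.coeFn_mk]
  constructor
  · rintro ⟨f, rfl⟩
    exact List.length_ofFn
  · rintro rfl
    exact ⟨x.get, List.ofFn_get x⟩

lemma card_binaryStrings (n : ℕ) : (binaryStrings n).card = 2 ^ n := by
  simp [binaryStrings]

/-- The tuples of binary strings with prescribed lengths `l`. -/
def stringTuples {d : ℕ} (l : Fin d → ℕ) : Finset (Fin d → List (Fin 2)) :=
  Fintype.piFinset fun i => binaryStrings (l i)

lemma mem_stringTuples {d : ℕ} {l : Fin d → ℕ} {x : Fin d → List (Fin 2)} :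
    x ∈ stringTuples l ↔ ∀ i, (x i).length = l i := by
  simp [stringTuples, Fintype.mem_piFinset, mem_binaryStrings]

lemma card_stringTuples {d : ℕ} (l : Fin d → ℕ) :
    (stringTuples l).card = 2 ^ ∑ i, l i := by
  simp [stringTuples, Fintype.card_piFinset, card_binaryStrings, Finset.prod_pow_eq_pow_sum]

/-- Revealing the first letter of the `i`-th string. -/
lemma sum_stringTuples_update {d : ℕ} (l : Fin d → ℕ) (i : Fin d) (k : ℕ) (hk : l i = k + 1)
    (f : (Fin d → List (Fin 2)) → ℝ) :
    ∑ x ∈ stringTuples l, f x =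
      ∑ b : Fin 2, ∑ x ∈ stringTuples (Function.update l i k),
        f (Function.update x i (b :: x i)) := by
  rw [← Finset.sum_product']
  symm
  refine Finset.sum_bij'
    (fun p _ => Function.update p.2 i (p.1 :: p.2 i))
    (fun x _ => ((x i).headI, Function.update x i (x i).tail)) ?_ ?_ ?_ ?_ ?_
  · rintro ⟨b, x⟩ h
    simp only [mem_product, mem_univ, true_and, mem_stringTuples] at h ⊢
    intro j
    have hj := h j
    by_cases hji : j = i
    · subst hji; simp at hj ⊢; omega
    · simpa [hji] using hj
  · intro x h
    simp only [mem_product, mem_univ, true_and, mem_stringTuples] at h ⊢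
    intro j
    have hj := h j
    by_cases hji : j = i
    · subst hji; simp; omega
    · simpa [hji] using hj
  · rintro ⟨b, x⟩ h
    simp
  · intro x h
    rw [mem_stringTuples] at h
    have hi := h i
    funext j
    by_cases hji : j = i
    · subst hji
      cases hx : x j with
      | nil => simp [hx, hk] at hi
      | cons a t => simp
    · simp [hji]
  · rintro ⟨b, x⟩ h
    rfl

/-- Revealing the first letters of all strings simultaneously. -/
lemma sum_stringTuples_add_one {d : ℕ} (l : Fin d → ℕ)
    (f : (Fin d → List (Fin 2)) → ℝ) :
    ∑ x ∈ stringTuples (fun i => l i + 1), f x =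
      ∑ b : Fin d → Fin 2, ∑ x ∈ stringTuples l, f (fun i => b i :: x i) := by
  rw [← Finset.sum_product']
  symm
  refine Finset.sum_bij'
    (fun p _ => fun i => p.1 i :: p.2 i)
    (fun x _ => (fun i => (x i).headI, fun i => (x i).tail)) ?_ ?_ ?_ ?_ ?_
  · rintro ⟨b, x⟩ h
    simp only [mem_product, mem_univ, true_and, mem_stringTuples] at h ⊢
    simpa using h
  · intro x h
    simp only [mem_product, mem_univ, true_and, mem_stringTuples] at h ⊢
    simp [h]
  · rintro ⟨b, x⟩ h
    simp
  · intro x h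
    rw [mem_stringTuples] at h
    funext i
    have hi := h i
    cases hx : x i with
    | nil => simp [hx] at hi
    | cons a t => simp [hx]
  · rintro ⟨b, x⟩ h
    rfl

/-- There is a word `w` of length `m` that is a subsequence of every `x i`, and such that even
`v :: w` is a subsequence of the `x i` with `i ∈ W`. -/
def HasCommonWord {d : ℕ} (m : ℕ) (v : Fin 2) (W : Finset (Fin d))
    (x : Fin d → List (Fin 2)) : Prop :=
  ∃ w : List (Fin 2), w.length = m ∧ ∀ i, (if i ∈ W then v :: w else w).Sublist (x i)

open Classical in
/-- The number of tuples of strings with lengths `l` violating `HasCommonWord m v W`. -/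
noncomputable def failCount {d : ℕ} (m : ℕ) (v : Fin 2) (W : Finset (Fin d))
    (l : Fin d → ℕ) : ℝ :=
  ∑ x ∈ stringTuples l, if HasCommonWord m v W x then 0 else 1

lemma failCount_le_two_pow {d : ℕ} (m : ℕ) (v : Fin 2) (W : Finset (Fin d))
    (l : Fin d → ℕ) : failCount m v W l ≤ 2 ^ ∑ i, l i := by
  classical
  calc failCount m v W l ≤ ∑ x ∈ stringTuples l, (1 : ℝ) := by
        refine Finset.sum_le_sum fun x _ => ?_
        split_ifs <;> norm_num
    _ = 2 ^ ∑ i, l i := by simp [card_stringTuples]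

open Classical in
lemma ite_zero_one_le_of_imp {P Q : Prop} (h : P → Q) :
    (if Q then (0 : ℝ) else 1) ≤ if P then 0 else 1 := by
  by_cases hP : P
  · simp [hP, h hP]
  · split_ifs <;> norm_num

lemma failCount_le_update {d : ℕ} (m : ℕ) (v : Fin 2) (W : Finset (Fin d))
    (l : Fin d → ℕ) (i : Fin d) (hi : i ∈ W) (k : ℕ) (hk : l i = k + 1) :
    failCount m v W l ≤ failCount m v (W.erase i) (Function.update l i k) +
      failCount m v W (Function.update l i k) := by
  classical
  have hv : ∀ x : Fin d → List (Fin 2), HasCommonWord m v (W.erase i) x →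
      HasCommonWord m v W (Function.update x i (v :: x i)) := by
    rintro x ⟨w, hw, h⟩
    refine ⟨w, hw, fun j => ?_⟩
    have hj := h j
    by_cases hji : j = i
    · subst hji
      simpa [hi] using hj
    · simpa [hji] using hj
  have hb : ∀ (b : Fin 2) (x : Fin d → List (Fin 2)), HasCommonWord m v W x →
      HasCommonWord m v W (Function.update x i (b :: x i)) := by
    rintro b x ⟨w, hw, h⟩
    refine ⟨w, hw, fun j => ?_⟩
    have hj := h j
    by_cases hji : j = i
    · subst hji
      rw [Function.update_self]
      exact hj.cons _
    · simpa [hji] using hj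
  have hsum : ∀ F : Fin 2 → ℝ, ∑ b, F b = F v + F (v + 1) := by
    intro F
    fin_cases v <;> simp [add_comm]
  unfold failCount
  rw [sum_stringTuples_update l i k hk, hsum]
  gcongr with x _ x _
  · exact ite_zero_one_le_of_imp (hv x)
  · exact ite_zero_one_le_of_imp (hb _ x)

lemma failCount_succ_le {d : ℕ} (m : ℕ) (u : Fin 2) (maj : (Fin d → Fin 2) → Fin 2)
    (l : Fin d → ℕ) :
    failCount (m + 1) u ∅ (fun i => l i + 1) ≤
      ∑ b : Fin d → Fin 2, failCount m (maj b) {i | b i ≠ maj b} l := by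
  classical
  unfold failCount
  rw [sum_stringTuples_add_one]
  refine Finset.sum_le_sum fun b _ => Finset.sum_le_sum fun x _ => ?_
  refine ite_zero_one_le_of_imp ?_
  rintro ⟨w, hw, h⟩
  refine ⟨maj b :: w, by simp [hw], fun i => ?_⟩
  have hi := h i
  by_cases hb : b i = maj b
  · simpa [hb] using hi
  · simp only [mem_filter, mem_univ, true_and, ne_eq, hb, not_false_eq_true, if_true] at hi
    simpa using hi.cons (b i)

/-- Exponential moment bound for the greedy matching strategy that always appends the letter
`maj b`, where `b` is the tuple of the next letters. -/
lemma failCount_le {d : ℕ} (z g M : ℝ) (maj : (Fin d → Fin 2) → Fin 2)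
    (hz : 0 < z) (hg : 1 ≤ g) (hM : 1 ≤ M) (hzg : 2 * z * g = 1 + g)
    (hmaj : ∀ i, ∑ b : Fin d → Fin 2, (if b i ≠ maj b then g else 1) = 2 ^ d * (z * M))
    (hd : 0 < d) (N : ℕ) :
    ∀ (m : ℕ) (v : Fin 2) (W : Finset (Fin d)) (l : Fin d → ℕ), ∑ i, l i = N →
      failCount m v W l ≤
        2 ^ N * (M ^ m * ∑ i, (if i ∈ W then g else 1) * z ^ l i) := by
  classical
  induction N using Nat.strong_induction_on with
  | _ N ih =>
  intro m v W l hN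
  have hnonneg : ∀ i, 0 ≤ (if i ∈ W then g else 1) * z ^ l i := by
    intro i
    split_ifs <;> positivity
  have hzero : ∀ i, l i = 0 → failCount m v W l ≤
      2 ^ N * (M ^ m * ∑ i, (if i ∈ W then g else 1) * z ^ l i) := by
    intro i hi
    have h1 : (1 : ℝ) ≤ ∑ i, (if i ∈ W then g else 1) * z ^ l i := by
      refine le_trans ?_ (Finset.single_le_sum (fun j _ => hnonneg j) (mem_univ i))
      rw [hi]
      split_ifs <;> simp [hg]
    have h2 : (1 : ℝ) ≤ M ^ m := one_le_pow₀ hM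
    have h3 : (1 : ℝ) ≤ M ^ m * ∑ i, (if i ∈ W then g else 1) * z ^ l i :=
      one_le_mul_of_one_le_of_one_le h2 h1
    calc failCount m v W l ≤ 2 ^ N := hN ▸ failCount_le_two_pow m v W l
      _ ≤ _ := le_mul_of_one_le_right (by positivity) h3
  by_cases hl : ∃ i, l i = 0
  · obtain ⟨i, hi⟩ := hl
    exact hzero i hi
  push Not at hl
  rcases W.eq_empty_or_nonempty with rfl | ⟨i, hi⟩
  · cases m with
    | zero =>
      have : failCount 0 v ∅ l = 0 := by
        unfold failCount
        refine Finset.sum_eq_zero fun x _ => if_pos ⟨[], rfl, fun i => by simp⟩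
      rw [this]
      have := Finset.sum_nonneg fun i (_ : i ∈ Finset.univ) => hnonneg i
      positivity
    | succ m =>
      obtain ⟨l', rfl⟩ : ∃ l' : Fin d → ℕ, l = fun i => l' i + 1 :=
        ⟨fun i => l i - 1, funext fun i => (Nat.sub_add_cancel (Nat.pos_of_ne_zero (hl i))).symm⟩
      have hN' : ∑ i, l' i + d = N := by
        rw [← hN, Finset.sum_add_distrib]; simp
      refine (failCount_succ_le m v maj l').trans ?_
      calc ∑ b : Fin d → Fin 2, failCount m (maj b) {i | b i ≠ maj b} l'
          ≤ ∑ b : Fin d → Fin 2, 2 ^ (∑ i, l' i) *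
              (M ^ m * ∑ i, (if b i ≠ maj b then g else 1) * z ^ l' i) := by
            refine Finset.sum_le_sum fun b _ => ?_
            have := ih (∑ i, l' i) (by omega) m (maj b) {i | b i ≠ maj b} l' rfl
            simpa only [mem_filter, mem_univ, true_and] using this
        _ = 2 ^ (∑ i, l' i) * (M ^ m * ∑ i,
              (∑ b : Fin d → Fin 2, (if b i ≠ maj b then g else 1)) * z ^ l' i) := by
            rw [← Finset.mul_sum, ← Finset.mul_sum, Finset.sum_comm]
            simp only [Finset.sum_mul]
        _ = 2 ^ N * (M ^ (m + 1) * ∑ i, (if i ∈ (∅ : Finset (Fin d)) then g else 1) *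
              z ^ (l' i + 1)) := by
            simp only [hmaj, ← hN', Finset.mul_sum]
            refine Finset.sum_congr rfl fun i _ => ?_
            simp
            ring
  · obtain ⟨k, hk⟩ := Nat.exists_eq_succ_of_ne_zero (hl i)
    have hsum : ∑ j, Function.update l i k j + 1 = N := by
      rw [← hN, ← Finset.add_sum_erase _ _ (mem_univ i), ← Finset.add_sum_erase _ l (mem_univ i),
        hk, Function.update_self]
      have : ∑ j ∈ univ.erase i, Function.update l i k j = ∑ j ∈ univ.erase i, l j :=
        Finset.sum_congr rfl fun j hj => Function.update_of_ne (Finset.ne_of_mem_erase hj) _ _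
      omega
    refine (failCount_le_update m v W l i hi k hk).trans ?_
    refine (add_le_add
      (ih _ (by omega) m v (W.erase i) (Function.update l i k) rfl)
      (ih _ (by omega) m v W (Function.update l i k) rfl)).trans (le_of_eq ?_)
    rw [← mul_add, ← mul_add, ← Finset.sum_add_distrib, ← hsum, pow_succ, mul_assoc,
      mul_left_comm (2 : ℝ), Finset.mul_sum _ _ (2 : ℝ)]
    congr 2
    refine Finset.sum_congr rfl fun j _ => ?_
    by_cases hji : j = i
    · subst hji
      simp only [mem_erase, ne_eq, not_true_eq_false, false_and, if_false, hi, if_true,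
        Function.update_self, hk, Nat.succ_eq_add_one, pow_succ]
      linear_combination (-z ^ k) * hzg
    · simp only [mem_erase, ne_eq, hji, not_false_eq_true, true_and, Function.update_of_ne]
      ring

/-- The sign `1` of the letter `0` and `-1` of the letter `1`. -/
def letterSign (b : Fin 2) : ℝ := if b = 0 then 1 else -1

/-- The letter `0` count minus the letter `1` count. -/
def signSum {d : ℕ} (b : Fin d → Fin 2) : ℝ := ∑ i, letterSign (b i)

open Classical in
/-- The most frequent letter of `b`. -/
noncomputable def majority {d : ℕ} (b : Fin d → Fin 2) : Fin 2 := if 0 ≤ signSum b then 0 else 1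

lemma signSum_mul_majority {d : ℕ} (b : Fin d → Fin 2) :
    signSum b * letterSign (majority b) = |signSum b| := by
  unfold majority
  split_ifs with h
  · simp [letterSign, abs_of_nonneg h]
  · simp [letterSign, abs_of_neg (not_le.mp h)]

lemma abs_letterSign (b : Fin 2) : |letterSign b| = 1 := by
  unfold letterSign; split_ifs <;> simp

lemma abs_signSum_le {d : ℕ} (b : Fin d → Fin 2) : |signSum b| ≤ d := by
  refine (Finset.abs_sum_le_sum_abs _ _).trans ?_
  simp [abs_letterSign]

lemma sum_signSum_cons (d : ℕ) (f : ℝ → ℝ) :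
    ∑ b : Fin (d + 1) → Fin 2, f (signSum b) =
      ∑ b : Fin d → Fin 2, (f (1 + signSum b) + f (-1 + signSum b)) := by
  rw [← (Fin.consEquiv fun _ => Fin 2).sum_comp, Fintype.sum_prod_type, Fin.sum_univ_two,
    ← Finset.sum_add_distrib]
  refine Finset.sum_congr rfl fun b _ => ?_
  simp [Fin.consEquiv, signSum, Fin.sum_univ_succ, letterSign]

lemma sum_signSum_sq (d : ℕ) : ∑ b : Fin d → Fin 2, signSum b ^ 2 = 2 ^ d * d := by
  induction d with
  | zero => simp [signSum]
  | succ d ih =>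
    rw [sum_signSum_cons d (· ^ 2)]
    have : ∀ s : ℝ, (1 + s) ^ 2 + (-1 + s) ^ 2 = 2 * s ^ 2 + 2 := fun s => by ring
    simp only [this, Finset.sum_add_distrib, ← Finset.mul_sum, ih]
    simp
    ring

lemma sum_signSum_pow_four (d : ℕ) :
    ∑ b : Fin d → Fin 2, signSum b ^ 4 = 2 ^ d * (3 * d ^ 2 - 2 * d) := by
  induction d with
  | zero => simp [signSum]
  | succ d ih =>
    rw [sum_signSum_cons d (· ^ 4)]
    have : ∀ s : ℝ, (1 + s) ^ 4 + (-1 + s) ^ 4 = 2 * s ^ 4 + 12 * s ^ 2 + 2 := fun s => by ring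
    simp only [this, Finset.sum_add_distrib, ← Finset.mul_sum, ih, sum_signSum_sq]
    simp
    ring

/-- The `L¹` Khintchine inequality for unweighted sign sums. -/
lemma le_sum_abs_signSum {d : ℕ} (hd : 0 < d) :
    2 ^ d * (√d / 4) ≤ ∑ b : Fin d → Fin 2, |signSum b| := by
  have hr : 0 < √(d : ℝ) := Real.sqrt_pos.mpr (by exact_mod_cast hd)
  have hr2 : √(d : ℝ) ^ 2 = d := Real.sq_sqrt (Nat.cast_nonneg d)
  set r := √(d : ℝ)
  have key : ∀ s : ℝ, s ^ 2 / r - s ^ 4 / (4 * r ^ 3) ≤ |s| := by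
    intro s
    rw [← sq_abs s, show s ^ 4 = |s| ^ 4 by rw [Even.pow_abs (by decide)]]
    have ht : 0 ≤ |s| := abs_nonneg s
    set t := |s|
    have e : t ^ 2 / r - t ^ 4 / (4 * r ^ 3) = t * (4 * t * r ^ 2 - t ^ 3) / (4 * r ^ 3) := by
      field_simp
    rw [e, div_le_iff₀ (by positivity)]
    refine mul_le_mul_of_nonneg_left ?_ ht
    nlinarith [mul_nonneg (add_nonneg ht hr.le) (sq_nonneg (t - r)), pow_pos hr 3,
      mul_nonneg ht (sq_nonneg (t - r)), mul_nonneg ht (sq_nonneg (2 * t - 3 * r)),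
      mul_nonneg hr.le (sq_nonneg (t - r)), mul_nonneg hr.le (sq_nonneg (4 * t - 5 * r)),
      mul_nonneg ht (sq_nonneg (4 * t - 5 * r))]
  have hle := Finset.sum_le_sum fun (b : Fin d → Fin 2) (_ : b ∈ univ) => key (signSum b)
  refine le_trans ?_ hle
  rw [Finset.sum_sub_distrib, ← Finset.sum_div, ← Finset.sum_div, sum_signSum_sq,
    sum_signSum_pow_four, ← hr2, ← mul_div_assoc, div_sub_div _ _ hr.ne' (by positivity),
    div_le_div_iff₀ (by positivity) (by positivity)]
  have : 0 < (2 : ℝ) ^ d := by positivity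
  have h5 : 0 < (2 : ℝ) ^ d * r ^ 3 := by positivity
  nlinarith

lemma sum_letterSign_mul_majority_eq {d : ℕ} (i j : Fin d) :
    ∑ b : Fin d → Fin 2, letterSign (b i) * letterSign (majority b) =
      ∑ b : Fin d → Fin 2, letterSign (b j) * letterSign (majority b) := by
  rw [← ((Equiv.swap i j).arrowCongr (Equiv.refl (Fin 2))).sum_comp]
  refine Finset.sum_congr rfl fun b _ => ?_
  have h : signSum (((Equiv.swap i j).arrowCongr (Equiv.refl (Fin 2))) b) = signSum b := by
    unfold signSum
    exact Equiv.sum_comp (Equiv.swap i j) fun k => letterSign (b k)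
  simp [majority, h]

/-- The mean advantage of the majority letter over the minority letter. -/
noncomputable def majorityBias (d : ℕ) : ℝ := (∑ b : Fin d → Fin 2, |signSum b|) / (2 ^ d * d)

lemma majorityBias_le_one (d : ℕ) : majorityBias d ≤ 1 := by
  refine div_le_one_of_le₀ ?_ (by positivity)
  calc ∑ b : Fin d → Fin 2, |signSum b| ≤ ∑ b : Fin d → Fin 2, (d : ℝ) :=
        Finset.sum_le_sum fun b _ => abs_signSum_le b
    _ = _ := by simp

lemma le_majorityBias {d : ℕ} (hd : 0 < d) : 1 / (4 * √d) ≤ majorityBias d := by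
  have hd' : (0 : ℝ) < d := by exact_mod_cast hd
  have hr : 0 < √(d : ℝ) := Real.sqrt_pos.mpr hd'
  unfold majorityBias
  rw [le_div_iff₀ (by positivity)]
  refine le_trans (le_of_eq ?_) (le_sum_abs_signSum hd)
  nth_rewrite 2 [← Real.sq_sqrt hd'.le]
  field_simp

lemma sum_letterSign_mul_majority {d : ℕ} (i : Fin d) :
    ∑ b : Fin d → Fin 2, letterSign (b i) * letterSign (majority b) =
      2 ^ d * majorityBias d := by
  have hd : (0 : ℝ) < d := by exact_mod_cast i.pos
  have h : ∑ j : Fin d, ∑ b : Fin d → Fin 2, letterSign (b j) * letterSign (majority b) =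
      ∑ b : Fin d → Fin 2, |signSum b| := by
    rw [Finset.sum_comm]
    refine Finset.sum_congr rfl fun b _ => ?_
    rw [← Finset.sum_mul, ← signSum_mul_majority]
    rfl
  rw [Finset.sum_congr rfl fun j _ => sum_letterSign_mul_majority_eq j i] at h
  simp only [sum_const, card_univ, Fintype.card_fin, nsmul_eq_mul] at h
  rw [majorityBias, ← h]
  field_simp

lemma sum_ite_ne_majority {d : ℕ} (g : ℝ) (i : Fin d) :
    ∑ b : Fin d → Fin 2, (if b i ≠ majority b then g else 1) =
      2 ^ d * ((1 + g) / 2 - (g - 1) / 2 * majorityBias d) := by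
  have h : ∀ a c : Fin 2, (if a ≠ c then g else 1) =
      (1 + g) / 2 - (g - 1) / 2 * (letterSign a * letterSign c) := by
    intro a c
    fin_cases a <;> fin_cases c <;> simp [letterSign] <;> ring
  simp only [h, Finset.sum_sub_distrib, ← Finset.mul_sum, sum_letterSign_mul_majority]
  simp
  ring

lemma sum_ofFn_eq_sum_stringTuples (d n : ℕ) (f : (Fin d → List (Fin 2)) → ℝ) :
    ∑ X : Fin d → Fin n → Fin 2, f (fun i => List.ofFn (X i)) =
      ∑ x ∈ stringTuples fun _ : Fin d => n, f x := by
  refine Finset.sum_bij (fun X _ i => List.ofFn (X i)) ?_ ?_ ?_ ?_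
  · intro X _
    simp [mem_stringTuples]
  · intro X _ Y _ h
    funext i
    exact List.ofFn_injective (congrFun h i)
  · intro x hx
    rw [mem_stringTuples] at hx
    refine ⟨fun i j => (x i).get (j.cast (hx i).symm), mem_univ _, funext fun i => ?_⟩
    refine List.ext_get (by simp [hx]) fun k h1 h2 => by simp
  · intro X _
    rfl

lemma lcsLen_le {k d n : ℕ} (hd : 0 < d) (X : Fin d → List (Fin k))
    (hX : ∀ i, (X i).length = n) : lcsLen d X ≤ n := by
  refine csSup_le ⟨0, [], rfl, fun i => by simp⟩ ?_
  rintro m ⟨w, rfl, h⟩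
  exact hX ⟨0, hd⟩ ▸ (h ⟨0, hd⟩).length_le

lemma le_lcsLen {k d n : ℕ} (hd : 0 < d) (X : Fin d → List (Fin k))
    (w : List (Fin k)) (h : ∀ i, w.Sublist (X i)) (hX : ∀ i, (X i).length = n) :
    w.length ≤ lcsLen d X := by
  refine le_csSup ⟨n, ?_⟩ ⟨w, rfl, h⟩
  rintro m ⟨w, rfl, h⟩
  exact hX ⟨0, hd⟩ ▸ (h ⟨0, hd⟩).length_le

lemma expLCS_two_le {d : ℕ} (hd : 0 < d) (n : ℕ) : expLCS 2 d n ≤ n := by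
  unfold expLCS
  refine div_le_of_le_mul₀ (by positivity) (by positivity) ?_
  calc _ ≤ ∑ X : Fin d → Fin n → Fin 2, (n : ℝ) :=
        Finset.sum_le_sum fun X _ => by exact_mod_cast lcsLen_le hd _ fun i => by simp
    _ = _ := by rw [Finset.sum_const, nsmul_eq_mul, mul_comm]; rfl

lemma le_expLCS_two {d : ℕ} (hd : 0 < d) (m n : ℕ) :
    m * (1 - failCount m 0 ∅ (fun _ : Fin d => n) / 2 ^ (d * n)) ≤ expLCS 2 d n := by
  classical
  unfold expLCS
  rw [sum_ofFn_eq_sum_stringTuples d n fun x => (lcsLen d x : ℝ)]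
  have hc : (Fintype.card (Fin d → Fin n → Fin 2) : ℝ) = 2 ^ (d * n) := by
    simp [← pow_mul, mul_comm]
  rw [hc, le_div_iff₀ (by positivity), mul_assoc, sub_mul, div_mul_cancel₀ _ (by positivity)]
  have hcard : (∑ x ∈ stringTuples fun _ : Fin d => n, (1 : ℝ)) = 2 ^ (d * n) := by
    simp [card_stringTuples]
  rw [one_mul, ← hcard, failCount, ← Finset.sum_sub_distrib, Finset.mul_sum]
  refine Finset.sum_le_sum fun x hx => ?_
  rw [mem_stringTuples] at hx
  split_ifs with h
  · obtain ⟨w, hw, h⟩ := h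
    have : w.length ≤ lcsLen d x := le_lcsLen hd x w (by simpa using h) hx
    rw [hw] at this
    simpa using this
  · simp

/-- The greedy majority strategy produces common subsequences of length `m` except with
exponentially small probability. -/
lemma failCount_majority_le {d : ℕ} (hd : 0 < d) {η : ℝ} (h0 : 0 < η) (h1 : η < 1) (m n : ℕ) :
    failCount m 0 ∅ (fun _ : Fin d => n) / 2 ^ (d * n) ≤
      d * (((1 + η) * (1 - majorityBias d * η) / (1 - η)) ^ m * ((1 + η)⁻¹) ^ n) := by
  have hη : 0 < 1 - η := by linarith
  have hκ := majorityBias_le_one d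
  set κ := majorityBias d
  have hM : 1 ≤ (1 + η) * (1 - κ * η) / (1 - η) := by
    rw [le_div_iff₀ hη]
    nlinarith [mul_nonneg h0.le (sub_nonneg.mpr hκ), mul_pos h0 hη,
      mul_nonneg (mul_pos h0 h0).le (sub_nonneg.mpr hκ)]
  have h := failCount_le (d := d) (1 + η)⁻¹ ((1 + η) / (1 - η))
    ((1 + η) * (1 - κ * η) / (1 - η)) majority (by positivity)
    (by rw [le_div_iff₀ hη]; linarith) hM (by field_simp; ring)
    (fun i => by
      rw [sum_ite_ne_majority]
      congr 1
      field_simp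
      ring) hd (d * n) m 0 ∅ (fun _ => n) (by simp)
  rw [div_le_iff₀ (by positivity)]
  refine h.trans (le_of_eq ?_)
  simp
  ring

open Filter Topology in
lemma le_liminf_expLCS_two {d : ℕ} (hd : 0 < d) :
    1 / 2 + majorityBias d / 8 ≤
      Filter.liminf (fun n : ℕ => expLCS 2 d n / n) Filter.atTop := by
  have hκ1 := majorityBias_le_one d
  have hκ0 : 0 < majorityBias d := lt_of_lt_of_le (by positivity) (le_majorityBias hd)
  have hfail := fun m n => failCount_majority_le hd (η := majorityBias d / 16) (by positivity)
    (by linarith) m n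
  set κ := majorityBias d
  set η := κ / 16 with hη
  set α := 1 / 2 + κ / 8 with hα
  set M := (1 + η) * (1 - κ * η) / (1 - η) with hMdef
  have hη0 : 0 < η := by positivity
  have hη1 : 0 < 1 - η := by linarith
  have hM : 1 ≤ M := by
    rw [hMdef, le_div_iff₀ hη1]
    nlinarith [mul_nonneg hη0.le (sub_nonneg.mpr hκ1), mul_pos hη0 hη1,
      mul_nonneg (mul_pos hη0 hη0).le (sub_nonneg.mpr hκ1)]
  have hM0 : 0 < M := by linarith
  have hrate : α * Real.log M - Real.log (1 + η) < 0 := by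
    have h1 : Real.log M ≤ (2 - κ) * η / (1 - η) := by
      refine (Real.log_le_sub_one_of_pos hM0).trans ?_
      rw [hMdef, div_sub_one hη1.ne', div_le_div_iff_of_pos_right hη1]
      nlinarith [mul_pos hκ0 hη0, mul_pos (mul_pos hκ0 hη0) hη0]
    have h2 : η / (1 + η) ≤ Real.log (1 + η) := by
      refine le_trans (le_of_eq ?_) (Real.one_sub_inv_le_log_of_pos (by positivity))
      field_simp
      ring
    have h3 : α * ((2 - κ) * η / (1 - η)) < η / (1 + η) := by
      rw [← mul_div_assoc, div_lt_div_iff₀ hη1 (by positivity)]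
      have : α * (2 - κ) * (1 + η) < 1 - η := by
        rw [hα, hη]
        nlinarith [mul_pos hκ0 hκ0, mul_pos (mul_pos hκ0 hκ0) hκ0]
      nlinarith
    have hα0 : 0 ≤ α := by positivity
    nlinarith [mul_le_mul_of_nonneg_left h1 hα0]
  set q := Real.exp (α * Real.log M - Real.log (1 + η)) with hq
  have hbound : ∀ n : ℕ, failCount ⌊α * n⌋₊ 0 ∅ (fun _ : Fin d => n) / 2 ^ (d * n) ≤
      d * q ^ n := by
    intro n
    refine (hfail ⌊α * n⌋₊ n).trans ?_
    refine mul_le_mul_of_nonneg_left ?_ (Nat.cast_nonneg d)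
    have hfl : (⌊α * n⌋₊ : ℝ) ≤ α * n := Nat.floor_le (by positivity)
    have e1 : M ^ ⌊α * n⌋₊ ≤ Real.exp (α * n * Real.log M) := by
      rw [← Real.exp_log (pow_pos hM0 _), Real.log_pow]
      exact Real.exp_le_exp.mpr (mul_le_mul_of_nonneg_right hfl (Real.log_nonneg hM))
    have e2 : ((1 + η)⁻¹) ^ n = Real.exp (n * (-Real.log (1 + η))) := by
      rw [Real.exp_nat_mul, Real.exp_neg, Real.exp_log (by positivity)]
    calc M ^ ⌊α * n⌋₊ * ((1 + η)⁻¹) ^ n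
        ≤ Real.exp (α * n * Real.log M) * ((1 + η)⁻¹) ^ n := by gcongr
      _ = q ^ n := by
        rw [e2, hq, ← Real.exp_nat_mul, ← Real.exp_add]
        congr 1
        ring
  have hlim : Tendsto (fun n : ℕ => (⌊α * n⌋₊ : ℝ) / n * (1 - d * q ^ n)) atTop (𝓝 α) := by
    have t1 : Tendsto (fun n : ℕ => (⌊α * n⌋₊ : ℝ) / n) atTop (𝓝 α) :=
      (tendsto_nat_floor_mul_div_atTop (by positivity)).comp tendsto_natCast_atTop_atTop
    have t2 : Tendsto (fun n : ℕ => q ^ n) atTop (𝓝 0) :=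
      tendsto_pow_atTop_nhds_zero_of_lt_one (Real.exp_pos _).le (Real.exp_lt_one_iff.mpr hrate)
    simpa using t1.mul ((t2.const_mul (d : ℝ)).const_sub 1)
  rw [← hlim.liminf_eq]
  refine liminf_le_liminf (Eventually.of_forall fun n => ?_) hlim.isBoundedUnder_ge ?_
  · rw [div_mul_eq_mul_div]
    refine div_le_div_of_nonneg_right ?_ (Nat.cast_nonneg n)
    refine le_trans ?_ (le_expLCS_two hd ⌊α * n⌋₊ n)
    exact mul_le_mul_of_nonneg_left (by linarith [hbound n]) (Nat.cast_nonneg _)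
  · refine IsBoundedUnder.isCoboundedUnder_ge ⟨1, ?_⟩
    rw [eventually_map]
    exact Eventually.of_forall fun n =>
      div_le_one_of_le₀ (expLCS_two_le hd n) (Nat.cast_nonneg n)

/-- Lower bound: there is an absolute constant `c₁ > 0` such that for every `d ≥ 2`,
`liminf_{n→∞} E_{2,d}(n)/n ≥ 1/2 + c₁/√d`. -/
theorem binary_lower_bound :
    ∃ c₁ : ℝ, 0 < c₁ ∧ ∀ d : ℕ, 2 ≤ d →
      1 / 2 + c₁ / Real.sqrt d ≤
        Filter.liminf (fun n : ℕ => expLCS 2 d n / n) Filter.atTop := by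
  refine ⟨1 / 32, by norm_num, fun d hd => ?_⟩
  refine le_trans ?_ (le_liminf_expLCS_two (by omega))
  have h := le_majorityBias (d := d) (by omega)
  have e : 1 / 32 / √(d : ℝ) = 1 / (4 * √d) / 8 := by
    rw [div_div, div_div]
    ring
  rw [e]
  gcongr
end

section
/- There exists an absolute constant c2 > 0 such that for every integer d ≥ 2, limsup_{n→∞} E_{2,d}(n)/n ≤ 1/2 + c2/√d. (This is the upper-bound half of the theorem γ_{2,d} = 1/2 + Θ(1/√d).) -/
open Classical in
/-- The strings of length `n` containing `w` as a subsequence. -/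
noncomputable def superseqs (n : ℕ) (w : List (Fin 2)) : Finset (Fin n → Fin 2) :=
  Finset.univ.filter fun x => w.Sublist (List.ofFn x)

theorem mem_superseqs {n : ℕ} {w : List (Fin 2)} {x : Fin n → Fin 2} :
    x ∈ superseqs n w ↔ w.Sublist (List.ofFn x) := by
  simp [superseqs]

theorem card_superseqs_succ_cons_le (n : ℕ) (a : Fin 2) (w : List (Fin 2)) :
    (superseqs (n + 1) (a :: w)).card ≤ (superseqs n w).card + (superseqs n (a :: w)).card := by
  classical
  have hsub : superseqs (n + 1) (a :: w) ⊆
      (superseqs n w).image (fun x => (Fin.cons a x : Fin (n + 1) → Fin 2)) ∪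
      (superseqs n (a :: w)).image (fun x => (Fin.cons (1 - a) x : Fin (n + 1) → Fin 2)) := by
    intro x hx
    rw [mem_superseqs, List.ofFn_succ] at hx
    rw [Finset.mem_union, Finset.mem_image, Finset.mem_image]
    by_cases h : x 0 = a
    · left
      rw [h, List.cons_sublist_cons] at hx
      exact ⟨Fin.tail x, mem_superseqs.2 hx, by rw [← h, Fin.cons_self_tail]⟩
    · right
      have h' : x 0 = 1 - a := by
        have key : ∀ b c : Fin 2, b ≠ c → b = 1 - c := by decide
        exact key _ _ h
      have hx' : (a :: w).Sublist (List.ofFn fun i : Fin n => x i.succ) := by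
        cases hx with
        | cons _ h2 => exact h2
        | cons_cons _ _ => exact absurd rfl h
      exact ⟨Fin.tail x, mem_superseqs.2 hx', by rw [← h', Fin.cons_self_tail]⟩
  calc _ ≤ _ := Finset.card_le_card hsub
    _ ≤ _ := Finset.card_union_le _ _
    _ ≤ _ := add_le_add Finset.card_image_le Finset.card_image_le

theorem card_superseqs_mul_pow_le {t : ℝ} (ht : 1 ≤ t) (n : ℕ) (w : List (Fin 2)) :
    ((superseqs n w).card : ℝ) * t ^ w.length ≤ (1 + t) ^ n := by
  induction n generalizing w with
  | zero =>
    cases w with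
    | nil => simp [superseqs]
    | cons a w => simp [superseqs]
  | succ n ih =>
    cases w with
    | nil =>
      have h : ((superseqs (n + 1) []).card : ℝ) = 2 ^ (n + 1) := by simp [superseqs]
      rw [h, List.length_nil, pow_zero, mul_one]
      gcongr
      linarith
    | cons a w =>
      have h1 := ih w
      have h2 := ih (a :: w)
      have h3 : ((superseqs (n + 1) (a :: w)).card : ℝ) ≤
          (superseqs n w).card + (superseqs n (a :: w)).card := by
        exact_mod_cast card_superseqs_succ_cons_le n a w
      have ht0 : 0 ≤ t ^ (a :: w).length := by positivity
      calc ((superseqs (n + 1) (a :: w)).card : ℝ) * t ^ (a :: w).length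
          ≤ ((superseqs n w).card + (superseqs n (a :: w)).card) * t ^ (a :: w).length :=
            mul_le_mul_of_nonneg_right h3 ht0
        _ = t * ((superseqs n w).card * t ^ w.length) +
            (superseqs n (a :: w)).card * t ^ (a :: w).length := by
            rw [List.length_cons]; ring
        _ ≤ t * (1 + t) ^ n + (1 + t) ^ n := by
            gcongr
        _ = (1 + t) ^ (n + 1) := by ring

/-- Chernoff bound for the number of strings containing a given word. -/
theorem card_superseqs_le_exp {ε : ℝ} (hε : 0 ≤ ε) (n : ℕ) (w : List (Fin 2))
    (hw : (1 / 2 + ε) * n ≤ w.length) :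
    ((superseqs n w).card : ℝ) ≤ 2 ^ n * Real.exp (-(2 * ε ^ 2 * n)) := by
  have h := card_superseqs_mul_pow_le (Real.one_le_exp (x := 4 * ε) (by positivity)) n w
  have hcosh : 1 + Real.exp (4 * ε) ≤ 2 * Real.exp (2 * ε + 2 * ε ^ 2) := by
    have h1 := Real.cosh_le_exp_half_sq (2 * ε)
    rw [Real.cosh_eq] at h1
    have h2 : Real.exp (2 * ε) * Real.exp (2 * ε) = Real.exp (4 * ε) := by
      rw [← Real.exp_add]; ring_nf
    have h3 : Real.exp (2 * ε) * Real.exp (-(2 * ε)) = 1 := by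
      rw [← Real.exp_add]; simp
    have h4 : Real.exp (2 * ε + 2 * ε ^ 2) =
        Real.exp (2 * ε) * Real.exp ((2 * ε) ^ 2 / 2) := by
      rw [← Real.exp_add]; ring_nf
    rw [h4]
    nlinarith [Real.exp_pos (2 * ε)]
  have hlow : Real.exp (4 * ε * ((1 / 2 + ε) * n)) ≤ Real.exp (4 * ε) ^ w.length := by
    rw [← Real.exp_nat_mul, mul_comm (w.length : ℝ)]
    gcongr
  have hmain : ((superseqs n w).card : ℝ) * Real.exp (4 * ε * ((1 / 2 + ε) * n)) ≤
      2 ^ n * Real.exp (-(2 * ε ^ 2 * n)) * Real.exp (4 * ε * ((1 / 2 + ε) * n)) := by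
    calc _ ≤ ((superseqs n w).card : ℝ) * Real.exp (4 * ε) ^ w.length := by gcongr
      _ ≤ (1 + Real.exp (4 * ε)) ^ n := h
      _ ≤ (2 * Real.exp (2 * ε + 2 * ε ^ 2)) ^ n := by gcongr
      _ = _ := by
        rw [mul_pow, ← Real.exp_nat_mul, mul_assoc, ← Real.exp_add]
        ring_nf
  exact le_of_mul_le_mul_right hmain (Real.exp_pos _)

theorem exists_sublist_of_le_lcsLen {k d m : ℕ} {X : Fin d → List (Fin k)} (hd : 0 < d)
    (hm : m ≤ lcsLen d X) :
    ∃ w : Fin m → Fin k, ∀ i, (List.ofFn w).Sublist (X i) := by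
  have hmem : lcsLen d X ∈
      {m : ℕ | ∃ w : List (Fin k), w.length = m ∧ ∀ i : Fin d, w.Sublist (X i)} := by
    refine Nat.sSup_mem ⟨0, [], rfl, fun i => List.nil_sublist _⟩ ⟨(X ⟨0, hd⟩).length, ?_⟩
    rintro _ ⟨w, rfl, hw⟩
    exact (hw _).length_le
  obtain ⟨w, hlen, hw⟩ := hmem
  refine ⟨fun i => w[i.1]'(by omega), fun i => ?_⟩
  have : List.ofFn (fun i : Fin m => w[i.1]'(by omega)) = w.take m := by
    apply List.ext_getElem
    · simp; omega
    · intro j h1 h2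
      simp
  rw [this]
  exact (List.take_sublist _ _).trans (hw i)

theorem lcsLen_ofFn_le {k d n : ℕ} (hd : 0 < d) (X : Fin d → Fin n → Fin k) :
    lcsLen d (fun i => List.ofFn (X i)) ≤ n := by
  obtain ⟨w, hw⟩ := exists_sublist_of_le_lcsLen (X := fun i => List.ofFn (X i)) hd le_rfl
  simpa using (hw ⟨0, hd⟩).length_le

open Classical in
/-- Union bound over the candidate common subsequences of length `m`. -/
theorem card_le_lcsLen_le {d n m : ℕ} (hd : 0 < d) {B : ℝ}
    (hB : ∀ w : Fin m → Fin 2, ((superseqs n (List.ofFn w)).card : ℝ) ≤ B) :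
    ((Finset.univ.filter fun X : Fin d → Fin n → Fin 2 =>
      m ≤ lcsLen d (fun i => List.ofFn (X i))).card : ℝ) ≤ 2 ^ m * B ^ d := by
  have hsub : (Finset.univ.filter fun X : Fin d → Fin n → Fin 2 =>
      m ≤ lcsLen d (fun i => List.ofFn (X i))) ⊆
      Finset.univ.biUnion fun w : Fin m → Fin 2 =>
        Fintype.piFinset fun _ : Fin d => superseqs n (List.ofFn w) := by
    intro X hX
    obtain ⟨w, hw⟩ := exists_sublist_of_le_lcsLen hd (Finset.mem_filter.1 hX).2
    exact Finset.mem_biUnion.2 ⟨w, Finset.mem_univ _,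
      Fintype.mem_piFinset.2 fun i => mem_superseqs.2 (hw i)⟩
  have hcard := (Finset.card_le_card hsub).trans Finset.card_biUnion_le
  simp only [Fintype.card_piFinset, Finset.prod_const, Finset.card_univ, Fintype.card_fin]
    at hcard
  calc _ ≤ ((∑ w : Fin m → Fin 2, (superseqs n (List.ofFn w)).card ^ d : ℕ) : ℝ) := by
        exact_mod_cast hcard
    _ = ∑ w : Fin m → Fin 2, ((superseqs n (List.ofFn w)).card : ℝ) ^ d := by push_cast; rfl
    _ ≤ ∑ _w : Fin m → Fin 2, B ^ d :=
        Finset.sum_le_sum fun w _ => pow_le_pow_left₀ (Nat.cast_nonneg _) (hB w) d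
    _ = 2 ^ m * B ^ d := by simp

theorem expLCS_nonneg (k d n : ℕ) : 0 ≤ expLCS k d n := by
  unfold expLCS; positivity

theorem expLCS_two_le_s1 {d : ℕ} (hd : 0 < d) (n m : ℕ) {q : ℝ}
    (hq : ∀ w : Fin m → Fin 2, ((superseqs n (List.ofFn w)).card : ℝ) ≤ 2 ^ n * q) :
    expLCS 2 d n ≤ m + n * (2 ^ m * q ^ d) := by
  classical
  have hcard : (Fintype.card (Fin d → Fin n → Fin 2) : ℝ) = (2 ^ n) ^ d := by simp
  have hbad := card_le_lcsLen_le hd hq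
  rw [expLCS, hcard, div_le_iff₀ (by positivity)]
  calc ∑ X : Fin d → Fin n → Fin 2, (lcsLen d (fun i => List.ofFn (X i)) : ℝ)
      ≤ ∑ X : Fin d → Fin n → Fin 2, ((m : ℝ) + n *
          if m ≤ lcsLen d (fun i => List.ofFn (X i)) then 1 else 0) := by
        refine Finset.sum_le_sum fun X _ => ?_
        have h1 : (lcsLen d (fun i => List.ofFn (X i)) : ℝ) ≤ n := by
          exact_mod_cast lcsLen_ofFn_le hd X
        split_ifs with h
        · linarith [(Nat.cast_nonneg m : (0 : ℝ) ≤ m)]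
        · have h2 : (lcsLen d (fun i => List.ofFn (X i)) : ℝ) ≤ m := by
            exact_mod_cast (not_le.1 h).le
          linarith
    _ = m * (2 ^ n) ^ d + n * ((Finset.univ.filter fun X : Fin d → Fin n → Fin 2 =>
          m ≤ lcsLen d (fun i => List.ofFn (X i))).card : ℝ) := by
        rw [Finset.sum_add_distrib, ← Finset.mul_sum, Finset.sum_boole, Finset.sum_const,
          nsmul_eq_mul, Finset.card_univ, hcard]
        ring
    _ ≤ m * (2 ^ n) ^ d + n * (2 ^ m * (2 ^ n * q) ^ d) := by gcongr
    _ = _ := by rw [mul_pow]; ring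

theorem expLCS_two_div_le {d n : ℕ} (hd : 0 < d) (hn : 0 < n) :
    expLCS 2 d n / n ≤
      1 / 2 + 1 / Real.sqrt d + 1 / (n : ℝ) + 2 * (4 * Real.exp (-2)) ^ n := by
  set ε : ℝ := 1 / Real.sqrt d with hε
  have hd1 : (1 : ℝ) ≤ d := by exact_mod_cast hd
  have hε0 : 0 ≤ ε := by positivity
  have hε1 : ε ≤ 1 := by
    rw [hε, div_le_one (by positivity)]
    exact Real.one_le_sqrt.2 hd1
  have hεd : ε ^ 2 * d = 1 := by
    rw [hε, div_pow, Real.sq_sqrt (by positivity)]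
    field_simp
  have hn0 : (0 : ℝ) < n := by exact_mod_cast hn
  set m : ℕ := ⌈(1 / 2 + ε) * n⌉₊ with hm
  have hm1 : (1 / 2 + ε) * n ≤ m := Nat.le_ceil _
  have hm2 : (m : ℝ) < (1 / 2 + ε) * n + 1 := Nat.ceil_lt_add_one (by positivity)
  have hm3 : m ≤ 2 * n + 1 := by
    have : (m : ℝ) ≤ ((2 * n + 1 : ℕ) : ℝ) := by push_cast; nlinarith
    exact_mod_cast this
  have h := expLCS_two_le_s1 hd n m fun w =>
    card_superseqs_le_exp hε0 n (List.ofFn w) (by rwa [List.length_ofFn])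
  have hexp : Real.exp (-(2 * ε ^ 2 * n)) ^ d = Real.exp (-2) ^ n := by
    rw [← Real.exp_nat_mul, ← Real.exp_nat_mul]
    congr 1
    linear_combination (-2 * (n : ℝ)) * hεd
  have hpow : (2 : ℝ) ^ m ≤ 2 * 4 ^ n := by
    calc (2 : ℝ) ^ m ≤ 2 ^ (2 * n + 1) := pow_le_pow_right₀ (by norm_num) hm3
      _ = 2 * 4 ^ n := by rw [pow_succ, pow_mul]; norm_num; ring
  rw [hexp] at h
  rw [div_le_iff₀ hn0]
  calc expLCS 2 d n ≤ m + n * (2 ^ m * Real.exp (-2) ^ n) := h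
    _ ≤ ((1 / 2 + ε) * n + 1) + n * (2 * 4 ^ n * Real.exp (-2) ^ n) := by gcongr
    _ = _ := by rw [mul_pow]; field_simp

theorem four_mul_exp_neg_two_lt_one : 4 * Real.exp (-2) < 1 := by
  have h := Real.exp_one_gt_d9
  have h2 : Real.exp 2 = Real.exp 1 * Real.exp 1 := by rw [← Real.exp_add]; norm_num
  rw [Real.exp_neg, ← div_eq_mul_inv, div_lt_one (Real.exp_pos _), h2]
  nlinarith

/-- Upper bound: there is an absolute constant `c₂ > 0` such that for every `d ≥ 2`,
`limsup_{n→∞} E_{2,d}(n)/n ≤ 1/2 + c₂/√d`. -/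
theorem binary_upper_bound :
    ∃ c₂ : ℝ, 0 < c₂ ∧ ∀ d : ℕ, 2 ≤ d →
      Filter.limsup (fun n : ℕ => expLCS 2 d n / n) Filter.atTop ≤
        1 / 2 + c₂ / Real.sqrt d := by
  refine ⟨1, one_pos, fun d hd => ?_⟩
  have hlim : Filter.Tendsto (fun n : ℕ =>
      1 / 2 + 1 / Real.sqrt d + 1 / (n : ℝ) + 2 * (4 * Real.exp (-2)) ^ n) Filter.atTop
      (nhds (1 / 2 + 1 / Real.sqrt d)) := by
    have h1 := tendsto_one_div_atTop_nhds_zero_nat (𝕜 := ℝ)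
    have h2 := tendsto_pow_atTop_nhds_zero_of_lt_one (by positivity) four_mul_exp_neg_two_lt_one
    simpa using (h1.const_add (1 / 2 + 1 / Real.sqrt d)).add (h2.const_mul 2)
  have hle : ∀ᶠ n : ℕ in Filter.atTop, expLCS 2 d n / n ≤
      1 / 2 + 1 / Real.sqrt d + 1 / (n : ℝ) + 2 * (4 * Real.exp (-2)) ^ n :=
    (Filter.eventually_gt_atTop 0).mono fun n hn => expLCS_two_div_le (by omega) hn
  rw [← hlim.limsup_eq]
  refine Filter.limsup_le_limsup hle ?_ hlim.isBoundedUnder_le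
  exact Filter.IsBoundedUnder.isCoboundedUnder_le
    (Filter.isBoundedUnder_of ⟨0, fun n => div_nonneg (expLCS_nonneg 2 d n) n.cast_nonneg⟩)
end

section
/- There exist absolute constants c0, c2 > 0 such that for all integers k ≥ 2 and d with d ≥ c0·log k, limsup_{n→∞} E_{k,d}(n)/n ≤ (1/k)·(1 + c2·√(log k / d)). -/
open Classical in
/-- The number of strings of length `n` over `Fin k` that contain `w` as a subsequence. -/
noncomputable def superseqCount (k n : ℕ) (w : List (Fin k)) : ℕ :=
  (Finset.univ.filter fun x : Fin n → Fin k => w.Sublist (List.ofFn x)).card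

theorem superseqCount_cons_succ {k : ℕ} (n : ℕ) (a : Fin k) (w : List (Fin k)) :
    superseqCount k (n + 1) (a :: w) =
      superseqCount k n w + (k - 1) * superseqCount k n (a :: w) := by
  classical
  have hcond (b : Fin k) (x : Fin n → Fin k) :
      (a :: w).Sublist (b :: List.ofFn x) ↔
        if b = a then w.Sublist (List.ofFn x) else (a :: w).Sublist (List.ofFn x) := by
    rw [List.cons_sublist_cons']
    split_ifs with h
    · subst h
      exact ⟨fun h => h.elim (fun h => (List.sublist_cons_self _ _).trans h) (·.2),
        fun h => Or.inr ⟨rfl, h⟩⟩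
    · exact ⟨fun h' => h'.elim id fun h' => absurd h'.1.symm h, Or.inl⟩
  have hsplit : superseqCount k (n + 1) (a :: w) =
      ∑ b : Fin k, if b = a then superseqCount k n w else superseqCount k n (a :: w) := by
    simp only [superseqCount, Finset.card_filter]
    rw [← (Fin.consEquiv fun _ => Fin k).sum_comp, Fintype.sum_prod_type]
    refine Finset.sum_congr rfl fun b _ => ?_
    simp only [Fin.consEquiv, Equiv.coe_fn_mk, List.ofFn_cons, hcond]
    split_ifs <;> rfl
  rw [hsplit, ← Finset.add_sum_erase _ _ (Finset.mem_univ a), if_pos rfl,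
    Finset.sum_congr rfl fun b hb => if_neg (Finset.ne_of_mem_erase hb)]
  simp [Finset.card_erase_of_mem]

/-- Chernoff-type bound on the number of supersequences of a word. -/
theorem superseqCount_mul_pow_le {k : ℕ} {t : ℝ} (ht : 1 ≤ t) (n : ℕ) (w : List (Fin k)) :
    superseqCount k n w * t ^ w.length ≤ (k - 1 + t) ^ n := by
  classical
  induction n generalizing w with
  | zero =>
    cases w with
    | nil => simp [superseqCount]
    | cons a w => simp [superseqCount]
  | succ n ih =>
    cases w with
    | nil =>
      have : ((k : ℝ)) ^ (n + 1) ≤ (k - 1 + t) ^ (n + 1) := by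
        gcongr
        linarith
      simpa [superseqCount] using this
    | cons a w =>
      have hk : 1 ≤ k := a.pos
      have h₁ := mul_le_mul_of_nonneg_left (ih w) (by linarith : 0 ≤ t)
      have hk' : (0 : ℝ) ≤ k - 1 := by
        have : (1 : ℝ) ≤ k := by exact_mod_cast hk
        linarith
      have h₂ := mul_le_mul_of_nonneg_left (ih (a :: w)) hk'
      rw [superseqCount_cons_succ]
      push_cast [Nat.cast_sub hk]
      simp only [List.length_cons, pow_succ] at h₁ h₂ ⊢
      linarith

theorem lcsLen_le_of_forall {k d m : ℕ} {X : Fin d → List (Fin k)}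
    (h : ∀ w : List (Fin k), (∀ i, w.Sublist (X i)) → w.length ≤ m) : lcsLen d X ≤ m := by
  refine csSup_le ⟨0, [], rfl, fun _ => List.nil_sublist _⟩ ?_
  rintro _ ⟨w, rfl, hw⟩
  exact h w hw

open Classical in
/-- Union bound over all words of length `m`. -/
theorem card_exists_common_le (k d n m : ℕ) {t : ℝ} (ht : 1 ≤ t) :
    ((Finset.univ.filter fun X : Fin d → Fin n → Fin k =>
        ∃ w : List.Vector (Fin k) m, ∀ i, w.1.Sublist (List.ofFn (X i))).card : ℝ) ≤
      k ^ m * ((k - 1 + t) ^ n / t ^ m) ^ d := by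
  have hsub : (Finset.univ.filter fun X : Fin d → Fin n → Fin k =>
        ∃ w : List.Vector (Fin k) m, ∀ i, w.1.Sublist (List.ofFn (X i))) ⊆
      Finset.univ.biUnion fun w : List.Vector (Fin k) m => Fintype.piFinset fun _ : Fin d =>
        Finset.univ.filter fun x : Fin n → Fin k => w.1.Sublist (List.ofFn x) := by
    intro X
    simp
  have hcard := (Finset.card_le_card hsub).trans Finset.card_biUnion_le
  simp only [Fintype.card_piFinset_const] at hcard
  refine (Nat.cast_le.mpr hcard).trans ?_
  push_cast
  have hw (w : List.Vector (Fin k) m) :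
      ((Finset.univ.filter fun x : Fin n → Fin k => w.1.Sublist (List.ofFn x)).card : ℝ) ^ d ≤
        ((k - 1 + t) ^ n / t ^ m) ^ d := by
    have h := superseqCount_mul_pow_le ht n w.1
    rw [w.2] at h
    have h' := (le_div_iff₀ (by positivity)).mpr h
    unfold superseqCount at h'
    gcongr
  refine (Finset.sum_le_sum fun w _ => hw w).trans ?_
  simp [card_vector]

theorem expLCS_le {k d : ℕ} (hk : 0 < k) (hd : 0 < d) (n m : ℕ) {t : ℝ} (ht : 1 ≤ t) :
    expLCS k d n ≤ m + n * (k ^ m * ((1 + (t - 1) / k) ^ n / t ^ m) ^ d) := by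
  classical
  have hk' : (0 : ℝ) < k := by exact_mod_cast hk
  have hpt (X : Fin d → Fin n → Fin k) : (lcsLen d (fun i => List.ofFn (X i)) : ℝ) ≤
      m + n * (if ∃ w : List.Vector (Fin k) m, ∀ i, w.1.Sublist (List.ofFn (X i))
        then 1 else 0) := by
    split_ifs with h
    · have : lcsLen d (fun i => List.ofFn (X i)) ≤ n :=
        lcsLen_le_of_forall fun w hw => by simpa using (hw ⟨0, hd⟩).length_le
      have : (lcsLen d (fun i => List.ofFn (X i)) : ℝ) ≤ n := by exact_mod_cast this
      have : (0 : ℝ) ≤ m := by positivity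
      linarith
    · have : lcsLen d (fun i => List.ofFn (X i)) ≤ m := by
        refine lcsLen_le_of_forall fun w hw => ?_
        by_contra! hlt
        exact h ⟨⟨w.take m, by simp [hlt.le]⟩, fun i => (List.take_sublist m w).trans (hw i)⟩
      simpa using this
  have hcard : (Fintype.card (Fin d → Fin n → Fin k) : ℝ) = ((k : ℝ) ^ n) ^ d := by simp
  unfold expLCS
  rw [div_le_iff₀ (by rw [hcard]; positivity)]
  refine (Finset.sum_le_sum fun X _ => hpt X).trans ?_
  rw [Finset.sum_add_distrib, ← Finset.mul_sum, Finset.sum_boole, Finset.sum_const,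
    Finset.card_univ, nsmul_eq_mul, add_mul, mul_comm (m : ℝ), mul_assoc (n : ℝ)]
  gcongr
  refine (card_exists_common_le k d n m ht).trans_eq ?_
  have hbase : (k : ℝ) - 1 + t = k * (1 + (t - 1) / k) := by
    field_simp
    ring
  rw [hcard, hbase, mul_pow, mul_div_assoc, mul_pow]
  ring

theorem sq_div_three_le_mul_log_sub {ε : ℝ} (h₀ : 0 ≤ ε) (h₁ : ε ≤ 1) :
    ε ^ 2 / 3 ≤ (1 + ε) * Real.log (1 + ε) - ε := by
  have h := mul_le_mul_of_nonneg_left (Real.le_log_one_add_of_nonneg h₀)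
    (by linarith : 0 ≤ 1 + ε)
  have h' : (1 + ε) * (2 * ε / (ε + 2)) - ε = ε ^ 2 / (ε + 2) := by
    field_simp
    ring
  have : ε ^ 2 / 3 ≤ ε ^ 2 / (ε + 2) := by
    gcongr
    linarith
  linarith

/-- The failure probability in the union bound decays exponentially in `n`. -/
theorem union_bound_le_exp {k d n m : ℕ} {ε : ℝ} (hk : 0 < k) (h₀ : 0 ≤ ε) (h₁ : ε ≤ 1)
    (hε : 3 * Real.log k ≤ d * (ε ^ 2 / 3)) (hm : (1 + ε) * n / k ≤ m)
    (hm' : m ≤ (1 + ε) * n / k + 1) :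
    (k : ℝ) ^ m * ((1 + ε / k) ^ n / (1 + ε) ^ m) ^ d ≤
      k * Real.exp (-(Real.log k / k)) ^ n := by
  have hk' : (0 : ℝ) < k := by exact_mod_cast hk
  have hlogk : 0 ≤ Real.log k := Real.log_natCast_nonneg k
  have hlog : 0 ≤ Real.log (1 + ε) := Real.log_nonneg (by linarith)
  have hq : (0 : ℝ) ≤ n / k := by positivity
  have hkm : (k : ℝ) ^ m = Real.exp (m * Real.log k) := by
    rw [Real.exp_nat_mul, Real.exp_log hk']
  have htm : (1 + ε) ^ m = Real.exp (m * Real.log (1 + ε)) := by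
    rw [Real.exp_nat_mul, Real.exp_log (by linarith)]
  have hn : (1 + ε / k) ^ n ≤ Real.exp (n * (ε / k)) := by
    rw [Real.exp_nat_mul]
    gcongr
    linarith [Real.add_one_le_exp (ε / k)]
  have hbound : (1 + ε / k) ^ n / (1 + ε) ^ m ≤ Real.exp (-(n / k * (ε ^ 2 / 3))) := by
    rw [htm, div_le_iff₀ (Real.exp_pos _), ← Real.exp_add]
    refine hn.trans (Real.exp_le_exp.mpr ?_)
    have h₂ := mul_le_mul_of_nonneg_left (sq_div_three_le_mul_log_sub h₀ h₁) hq
    have h₃ := mul_le_mul_of_nonneg_right hm hlog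
    have e₁ : (1 + ε) * n / k * Real.log (1 + ε) =
      n / k * ((1 + ε) * Real.log (1 + ε)) := by ring
    have e₂ : n * (ε / k) = n / k * ε := by ring
    linarith
  calc (k : ℝ) ^ m * ((1 + ε / k) ^ n / (1 + ε) ^ m) ^ d
      ≤ Real.exp (m * Real.log k) * Real.exp (-(n / k * (ε ^ 2 / 3))) ^ d := by
        rw [hkm]
        gcongr
    _ = Real.exp (m * Real.log k + d * -(n / k * (ε ^ 2 / 3))) := by
        rw [← Real.exp_nat_mul, Real.exp_add]
    _ ≤ Real.exp (Real.log k + n * -(Real.log k / k)) := by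
        refine Real.exp_le_exp.mpr ?_
        have h₂ := mul_le_mul_of_nonneg_left hε hq
        have h₃ := mul_le_mul_of_nonneg_right hm' hlogk
        have h₄ : (1 + ε) * n / k * Real.log k ≤ 2 * (n / k) * Real.log k := by
          rw [mul_div_assoc]
          gcongr
          linarith
        have e₁ : n * -(Real.log k / k) = -(n / k * Real.log k) := by ring
        linarith
    _ = k * Real.exp (-(Real.log k / k)) ^ n := by
        rw [Real.exp_add, Real.exp_log hk', Real.exp_nat_mul]

theorem limsup_expLCS_div_le {k d : ℕ} {ε : ℝ} (hk : 2 ≤ k) (hd : 0 < d) (h₀ : 0 ≤ ε)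
    (h₁ : ε ≤ 1) (hε : 3 * Real.log k ≤ d * (ε ^ 2 / 3)) :
    Filter.limsup (fun n : ℕ => expLCS k d n / n) Filter.atTop ≤ (1 + ε) / k := by
  have hk' : (0 : ℝ) < k := by positivity
  have hlogk : 0 < Real.log k := Real.log_pos (by exact_mod_cast hk)
  set r := Real.exp (-(Real.log k / k))
  have hr : r < 1 := Real.exp_lt_one_iff.mpr (neg_lt_zero.mpr (by positivity))
  have hlim : Filter.Tendsto (fun n : ℕ => (1 + ε) / k + 1 / (n : ℝ) + k * r ^ n)
      Filter.atTop (nhds ((1 + ε) / k)) := by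
    simpa using ((tendsto_const_nhds (x := (1 + ε) / k)).add
      tendsto_one_div_atTop_nhds_zero_nat).add
        ((tendsto_pow_atTop_nhds_zero_of_lt_one (Real.exp_pos _).le hr).const_mul (k : ℝ))
  rw [← hlim.limsup_eq]
  refine Filter.limsup_le_limsup ?_ ?_ hlim.isBoundedUnder_le
  · filter_upwards [Filter.eventually_gt_atTop 0] with n hn
    have hn' : (0 : ℝ) < n := by exact_mod_cast hn
    have hm' := (Nat.ceil_lt_add_one (a := (1 + ε) * n / k) (by positivity)).le
    have hE := expLCS_le (by omega : 0 < k) hd n ⌈(1 + ε) * n / k⌉₊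
      (t := 1 + ε) (by linarith)
    have hU := mul_le_mul_of_nonneg_left
      (union_bound_le_exp (by omega) h₀ h₁ hε (Nat.le_ceil _) hm') hn'.le
    rw [add_sub_cancel_left] at hE
    rw [div_le_iff₀ hn']
    have e : ((1 + ε) / k + 1 / (n : ℝ) + k * r ^ n) * n =
        (1 + ε) * n / k + 1 + n * (k * r ^ n) := by
      field_simp
    rw [e]
    linarith
  · exact Filter.IsBoundedUnder.isCoboundedUnder_le
      ⟨0, Filter.eventually_map.mpr (.of_forall fun n =>
        div_nonneg (expLCS_nonneg k d n) n.cast_nonneg)⟩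

/-- There exist absolute constants `c₀, c₂ > 0` such that for all integers `k ≥ 2` and
`d ≥ c₀ · log₂ k`, `limsup_{n→∞} E_{k,d}(n)/n ≤ (1/k)·(1 + c₂·√(log₂ k / d))`. -/
theorem kary_upper_bound :
    ∃ c₀ : ℝ, 0 < c₀ ∧ ∃ c₂ : ℝ, 0 < c₂ ∧ ∀ k d : ℕ, 2 ≤ k →
      c₀ * Real.logb 2 k ≤ d →
      Filter.limsup (fun n : ℕ => expLCS k d n / n) Filter.atTop ≤
        (1 / k) * (1 + c₂ * Real.sqrt (Real.logb 2 k / d)) := by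
  refine ⟨9, by norm_num, 3, by norm_num, fun k d hk hd => ?_⟩
  have hlogk : 0 < Real.log k := Real.log_pos (by exact_mod_cast hk)
  have hle : Real.log k ≤ Real.logb 2 k := by
    rw [Real.logb, le_div_iff₀ (Real.log_pos one_lt_two)]
    nlinarith [Real.log_two_lt_d9]
  have hd' : (0 : ℝ) < d := by linarith
  have hq : 0 ≤ Real.logb 2 k / d := div_nonneg (by linarith) hd'.le
  have hsq : (3 * √(Real.logb 2 k / d)) ^ 2 = 9 * (Real.logb 2 k / d) := by
    rw [mul_pow, Real.sq_sqrt hq]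
    norm_num
  have hq₁ : 9 * (Real.logb 2 k / d) ≤ 1 := by
    rw [← mul_div_assoc, div_le_one hd']
    exact hd
  rw [one_div_mul_eq_div]
  refine limsup_expLCS_div_le hk (by exact_mod_cast hd') (by positivity) ?_ ?_
  · rw [← sq_le_one_iff₀ (by positivity), hsq]
    exact hq₁
  · have : (d : ℝ) * (9 * (Real.logb 2 k / d) / 3) = 3 * Real.logb 2 k := by
      field_simp
      ring
    rw [hsq, this]
    linarith
end

section
/- There exists an absolute constant c1 > 0 such that for every integer d ≥ 2 and all sufficiently large n, the expected diagonal LCS satisfies W_{nd} ≥ n·(1/2 + c1/√d), where W_m = E[ max over nonnegative integers i_1 + ⋯ + i_d = m of LCS(X^1[1..i_1], …, X^d[1..i_d]) ] and X^1, …, X^d are independent uniformly random binary strings of length m. -/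
/-- Given `d` binary strings of length `m`, the diagonal LCS: the maximum, over all
choices of nonnegative `i 0 + ⋯ + i (d-1) = m`, of the LCS of the prefixes
`X j [1..i j]`. -/
noncomputable def diagLCS (d m : ℕ) (X : Fin d → Fin m → Fin 2) : ℕ :=
  sSup {L : ℕ | ∃ i : Fin d → ℕ, (∑ j : Fin d, i j) = m ∧
    ∃ w : List (Fin 2), w.length = L ∧
      ∀ j : Fin d, w.Sublist ((List.ofFn (X j)).take (i j))}

/-- `W d m` is the expected diagonal LCS of `d` independent uniformly random binary
strings of length `m`. -/
noncomputable def W (d m : ℕ) : ℝ :=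
  (∑ X : Fin d → Fin m → Fin 2, (diagLCS d m X : ℝ)) /
    (Fintype.card (Fin d → Fin m → Fin 2) : ℝ)

open Finset
open scoped BigOperators

/-- The length of the longest common subsequence of prefixes of total length `B`. -/
noncomputable def budgetLCS (d m B : ℕ) (X : Fin d → Fin m → Fin 2) : ℕ :=
  sSup {L : ℕ | ∃ i : Fin d → ℕ, (∑ j : Fin d, i j) = B ∧
    ∃ w : List (Fin 2), w.length = L ∧
      ∀ j : Fin d, w.Sublist ((List.ofFn (X j)).take (i j))}

/-- The longest word `b :: w` such that, for some prefixes of total length `B`, the word `b :: w`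
is a subsequence of the prefixes indexed by `S` and `w` is a subsequence of the other ones
(`0` if there is no such word). -/
noncomputable def searchLCS (d m B : ℕ) (S : Finset (Fin d)) (b : Fin 2)
    (X : Fin d → Fin m → Fin 2) : ℕ :=
  sSup {L : ℕ | ∃ i : Fin d → ℕ, (∑ j : Fin d, i j) = B ∧
    ∃ w : List (Fin 2), w.length + 1 = L ∧
      ∀ j : Fin d, (if j ∈ S then b :: w else w).Sublist ((List.ofFn (X j)).take (i j))}

/-- Prepend the letter `x j` to the string `X j` and drop its last letter, for `j ∈ S`. -/
def prependOn {d m : ℕ} (S : Finset (Fin d)) (x : Fin d → Fin 2)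
    (X : Fin d → Fin (m + 1) → Fin 2) : Fin d → Fin (m + 1) → Fin 2 :=
  fun j => if j ∈ S then Fin.cons (x j) (Fin.init (X j)) else X j

theorem length_le_of_sublist_take_ofFn {m i : ℕ} {f : Fin m → Fin 2} {w : List (Fin 2)}
    (h : w.Sublist ((List.ofFn f).take i)) : w.length ≤ m := by
  have := (h.trans (List.take_sublist _ _)).length_le
  simpa using this

theorem bddAbove_budgetLCS {d : ℕ} (hd : 0 < d) (m B : ℕ) (X : Fin d → Fin m → Fin 2) :
    BddAbove {L : ℕ | ∃ i : Fin d → ℕ, (∑ j : Fin d, i j) = B ∧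
      ∃ w : List (Fin 2), w.length = L ∧
        ∀ j : Fin d, w.Sublist ((List.ofFn (X j)).take (i j))} := by
  refine ⟨m, ?_⟩
  rintro L ⟨i, -, w, rfl, hw⟩
  exact length_le_of_sublist_take_ofFn (hw ⟨0, hd⟩)

theorem bddAbove_searchLCS {d : ℕ} (hd : 0 < d) (m B : ℕ) (S : Finset (Fin d)) (b : Fin 2)
    (X : Fin d → Fin m → Fin 2) :
    BddAbove {L : ℕ | ∃ i : Fin d → ℕ, (∑ j : Fin d, i j) = B ∧
      ∃ w : List (Fin 2), w.length + 1 = L ∧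
        ∀ j : Fin d, (if j ∈ S then b :: w else w).Sublist
          ((List.ofFn (X j)).take (i j))} := by
  refine ⟨m + 1, ?_⟩
  rintro L ⟨i, -, w, rfl, hw⟩
  have hw' : w.Sublist ((List.ofFn (X ⟨0, hd⟩)).take (i ⟨0, hd⟩)) := by
    refine List.Sublist.trans ?_ (hw ⟨0, hd⟩)
    split_ifs
    · exact List.sublist_cons_self _ _
    · exact List.Sublist.refl _
  exact Nat.succ_le_succ (length_le_of_sublist_take_ofFn hw')

theorem searchLCS_univ_le {d : ℕ} (hd : 0 < d) (m B : ℕ) (b : Fin 2)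
    (X : Fin d → Fin m → Fin 2) :
    searchLCS d m B univ b X ≤ budgetLCS d m B X := by
  refine csSup_le_csSup' (bddAbove_budgetLCS hd m B X) ?_
  rintro L ⟨i, hi, w, rfl, hw⟩
  exact ⟨i, hi, b :: w, rfl, fun j => by simpa using hw j⟩

theorem budgetLCS_add_one_le {d : ℕ} (hd : 0 < d) (m B : ℕ) (b : Fin 2)
    (X : Fin d → Fin m → Fin 2) :
    budgetLCS d m B X + 1 ≤ searchLCS d m B ∅ b X := by
  have hne : {L : ℕ | ∃ i : Fin d → ℕ, (∑ j : Fin d, i j) = B ∧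
      ∃ w : List (Fin 2), w.length = L ∧
        ∀ j : Fin d, w.Sublist ((List.ofFn (X j)).take (i j))}.Nonempty :=
    ⟨0, Pi.single ⟨0, hd⟩ B, by simp, [], rfl, fun j => List.nil_sublist _⟩
  obtain ⟨i, hi, w, hL, hw⟩ := Nat.sSup_mem hne (bddAbove_budgetLCS hd m B X)
  refine le_csSup (bddAbove_searchLCS hd m B ∅ b X) ⟨i, hi, w, ?_, fun j => by simpa using hw j⟩
  rw [hL, budgetLCS]

theorem take_ofFn_cons_init {m i : ℕ} (hi : i ≤ m) (b : Fin 2) (f : Fin (m + 1) → Fin 2) :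
    (List.ofFn (Fin.cons b (Fin.init f) : Fin (m + 1) → Fin 2)).take (i + 1) =
      b :: (List.ofFn f).take i := by
  rw [List.ofFn_succ, List.take_succ_cons, List.ofFn_succ_last (f := f),
    List.take_append_of_le_length (by simpa using hi)]
  rfl

theorem searchLCS_le_prependOn {d : ℕ} (hd : 0 < d) {m B : ℕ} {S : Finset (Fin d)}
    (hS : S.Nonempty) (hSB : S.card ≤ B) (hB : B ≤ m + 1) (b : Fin 2) (x : Fin d → Fin 2)
    (X : Fin d → Fin (m + 1) → Fin 2) :
    searchLCS d (m + 1) (B - S.card) {j ∈ S | x j ≠ b} b X ≤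
      searchLCS d (m + 1) B S b (prependOn S x X) := by
  refine csSup_le_csSup' (bddAbove_searchLCS hd _ _ _ _ _) ?_
  rintro L ⟨i, hi, w, rfl, hw⟩
  refine ⟨fun j => i j + if j ∈ S then 1 else 0, ?_, w, rfl, fun j => ?_⟩
  · rw [sum_add_distrib, hi]
    simp
    omega
  · have hij : i j ≤ m := by
      have h1 : i j ≤ ∑ j, i j := single_le_sum (fun _ _ => Nat.zero_le _) (mem_univ j)
      have := hS.card_pos
      omega
    have hj := hw j
    by_cases hjS : j ∈ S
    · simp only [prependOn, hjS, if_true, take_ofFn_cons_init hij]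
      by_cases hxb : x j = b
      · subst hxb
        simp only [mem_filter, hjS, ne_eq, not_true, and_false, if_false] at hj
        exact hj.cons_cons _
      · simp only [mem_filter, hjS, ne_eq, hxb, not_false_eq_true, and_self, if_true] at hj
        exact hj.cons _
    · simpa [prependOn, hjS] using hj

theorem expect_prependOn {d m : ℕ} (S : Finset (Fin d))
    (f : (Fin d → Fin (m + 1) → Fin 2) → ℝ) :
    𝔼 X, f X = 𝔼 x : Fin d → Fin 2, 𝔼 X, f (prependOn S x X) := by
  let e : (Fin d → Fin 2) × (Fin d → Fin (m + 1) → Fin 2) ≃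
      (Fin d → Fin 2) × (Fin d → Fin (m + 1) → Fin 2) :=
    { toFun := fun p =>
        (fun j => if j ∈ S then p.2 j (Fin.last m) else p.1 j, prependOn S p.1 p.2)
      invFun := fun p =>
        (fun j => if j ∈ S then p.2 j 0 else p.1 j,
          fun j => if j ∈ S then Fin.snoc (Fin.tail (p.2 j)) (p.1 j) else p.2 j)
      left_inv := by
        rintro ⟨x, X⟩
        refine Prod.ext ?_ ?_ <;> funext j <;> by_cases hj : j ∈ S <;> simp [prependOn, hj]
      right_inv := by
        rintro ⟨x, X⟩
        refine Prod.ext ?_ ?_ <;> funext j <;> by_cases hj : j ∈ S <;> simp [prependOn, hj] }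
  have h := Fintype.expect_equiv e (fun p => f (prependOn S p.1 p.2)) (fun p => f p.2)
    (fun _ => rfl)
  rw [← univ_product_univ, expect_product, expect_product] at h
  rw [h]
  simp

theorem expect_card_filter_ne {d : ℕ} (S : Finset (Fin d)) (b : Fin 2) :
    𝔼 x : Fin d → Fin 2, (#{j ∈ S | x j ≠ b} : ℝ) = #S / 2 := by
  have hflip : 𝔼 x : Fin d → Fin 2, (#{j ∈ S | x j ≠ b} : ℝ) =
      𝔼 x : Fin d → Fin 2, (#{j ∈ S | x j = b} : ℝ) := by
    refine Fintype.expect_equiv (Equiv.piCongrRight fun _ => Equiv.swap 0 1) _ _ fun x => ?_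
    congr 2
    ext j
    simp only [mem_filter, Equiv.piCongrRight_apply, Pi.map_apply]
    generalize x j = a
    revert a b
    simp [Fin.forall_fin_two]
  have hsum : 𝔼 x : Fin d → Fin 2, (#{j ∈ S | x j = b} : ℝ) +
      𝔼 x : Fin d → Fin 2, (#{j ∈ S | x j ≠ b} : ℝ) = #S := by
    rw [← expect_add_distrib, ← Fintype.expect_const (ι := Fin d → Fin 2) (#S : ℝ)]
    refine expect_congr rfl fun x _ => ?_
    exact_mod_cast card_filter_add_card_filter_not (s := S) fun j => x j = b
  linarith

/-- The number of zeros minus the number of ones in `x`. -/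
def bias {d : ℕ} (x : Fin d → Fin 2) : ℝ := ∑ j, (1 - 2 * (x j : ℕ) : ℝ)

theorem exists_card_filter_ne_eq {d : ℕ} (x : Fin d → Fin 2) :
    ∃ b : Fin 2, (#{j | x j ≠ b} : ℝ) = (d - |bias x|) / 2 := by
  have h1 : bias x = d - 2 * #{j | x j ≠ 0} := by
    rw [bias, sum_sub_distrib, ← mul_sum, card_filter]
    push_cast
    simp only [sum_const, card_univ, Fintype.card_fin, nsmul_eq_mul, mul_one]
    congr 2
    refine sum_congr rfl fun j _ => ?_
    generalize x j = a
    revert a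
    simp [Fin.forall_fin_two]
  have h2 : (#{j | x j ≠ 0} : ℝ) + #{j | x j ≠ 1} = d := by
    have h := card_filter_add_card_filter_not (s := (univ : Finset (Fin d))) fun j => x j ≠ 0
    have h' : #{j | ¬ x j ≠ 0} = #{j | x j ≠ 1} := by
      congr 1
      ext j
      simp only [mem_filter, mem_univ, true_and]
      generalize x j = a
      revert a
      simp [Fin.forall_fin_two]
    rw [h'] at h
    simpa using congrArg (Nat.cast (R := ℝ)) h
  rcases le_total 0 (bias x) with h | h
  · exact ⟨0, by rw [abs_of_nonneg h]; linarith⟩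
  · exact ⟨1, by rw [abs_of_nonpos h]; linarith⟩

theorem expect_bias_succ {d : ℕ} (f : ℝ → ℝ) :
    𝔼 x : Fin (d + 1) → Fin 2, f (bias x) =
      𝔼 x : Fin d → Fin 2, (f (bias x + 1) + f (bias x - 1)) / 2 := by
  rw [← Fintype.expect_equiv (Fin.consEquiv fun _ : Fin (d + 1) => Fin 2)
    (fun p => f (bias (Fin.cons p.1 p.2 : Fin (d + 1) → Fin 2))) _ (fun _ => rfl),
    ← univ_product_univ, expect_product, expect_comm]
  refine expect_congr rfl fun x _ => ?_
  simp only [bias, Fin.sum_univ_succ, Fin.cons_zero, Fin.cons_succ]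
  rw [Fintype.expect_eq_sum_div_card, Fin.sum_univ_two]
  norm_num
  ring_nf

theorem expect_bias_sq (d : ℕ) : 𝔼 x : Fin d → Fin 2, bias x ^ 2 = d := by
  induction d with
  | zero => simp [bias]
  | succ d ih =>
    rw [expect_bias_succ fun s => s ^ 2]
    have h : ∀ x : Fin d → Fin 2, ((bias x + 1) ^ 2 + (bias x - 1) ^ 2) / 2 =
        bias x ^ 2 + 1 := fun x => by ring
    simp only [h, expect_add_distrib, ih, Fintype.expect_const]
    push_cast
    ring

theorem expect_bias_pow_four (d : ℕ) :
    𝔼 x : Fin d → Fin 2, bias x ^ 4 = 3 * d ^ 2 - 2 * d := by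
  induction d with
  | zero => simp [bias]
  | succ d ih =>
    rw [expect_bias_succ fun s => s ^ 4]
    have h : ∀ x : Fin d → Fin 2, ((bias x + 1) ^ 4 + (bias x - 1) ^ 4) / 2 =
        bias x ^ 4 + 6 * bias x ^ 2 + 1 := fun x => by ring
    simp only [h, expect_add_distrib, ih, Fintype.expect_const, ← mul_expect, expect_bias_sq]
    push_cast
    ring

/-- A Khinchine-type inequality, from the second and fourth moments. -/
theorem sqrt_le_expect_abs_bias {d : ℕ} (hd : 0 < d) :
    √d / 4 ≤ 𝔼 x : Fin d → Fin 2, |bias x| := by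
  set r : ℝ := √d
  have hr : 0 < r := Real.sqrt_pos.2 (by exact_mod_cast hd)
  have hrd : r ^ 2 = d := Real.sq_sqrt (Nat.cast_nonneg d)
  have key : ∀ x : Fin d → Fin 2,
      bias x ^ 2 * (1 / r) - bias x ^ 4 * (1 / (4 * r ^ 3)) ≤ |bias x| := by
    intro x
    rw [← sq_abs (bias x), show bias x ^ 4 = |bias x| ^ 4 from (Even.pow_abs ⟨2, rfl⟩ _).symm]
    have hs := abs_nonneg (bias x)
    generalize |bias x| = s at hs
    have h : s - (s ^ 2 * (1 / r) - s ^ 4 * (1 / (4 * r ^ 3))) =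
        s * (s ^ 3 - 4 * s * r ^ 2 + 4 * r ^ 3) / (4 * r ^ 3) := by
      field_simp
      ring
    have h3 : 0 ≤ s ^ 3 - 4 * s * r ^ 2 + 4 * r ^ 3 := by
      nlinarith [mul_nonneg (add_nonneg hs hr.le) (sq_nonneg (2 * s - 2 * r)),
        mul_nonneg hs (sq_nonneg (s - r)), mul_nonneg hr.le (sq_nonneg (s - r)),
        mul_nonneg hr.le (sq_nonneg (5 * s - 6 * r)), mul_nonneg hs (sq_nonneg (5 * s - 6 * r))]
    have : 0 ≤ s * (s ^ 3 - 4 * s * r ^ 2 + 4 * r ^ 3) / (4 * r ^ 3) := by positivity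
    linarith
  refine le_trans ?_ (expect_le_expect fun x _ => key x)
  rw [expect_sub_distrib, ← expect_mul, ← expect_mul, expect_bias_sq, expect_bias_pow_four, ← hrd]
  rw [← sub_nonneg]
  have h : r ^ 2 * (1 / r) - (3 * (r ^ 2) ^ 2 - 2 * r ^ 2) * (1 / (4 * r ^ 3)) - r / 4 =
      1 / (2 * r) := by
    field_simp
    ring
  rw [h]
  positivity

theorem expect_searchLCS_and_budgetLCS_ge {d : ℕ} (hd : 0 < d) (m B : ℕ) (hB : B ≤ m + 1)
    {τ : ℝ} (hτ : 2 * d - √d / 4 ≤ τ) (hdτ : d ≤ τ) :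
    (∀ (S : Finset (Fin d)) (b : Fin 2),
      (B - 2 * #S : ℝ) / τ ≤ 𝔼 X, (searchLCS d (m + 1) B S b X : ℝ)) ∧
      (B : ℝ) / τ - 1 ≤ 𝔼 X, (budgetLCS d (m + 1) B X : ℝ) := by
  have hd' : (0 : ℝ) < d := by exact_mod_cast hd
  have hτ0 : 0 < τ := hd'.trans_le hdτ
  have : Nonempty (Fin d) := ⟨⟨0, hd⟩⟩
  induction B using Nat.strong_induction_on with
  | _ B ih =>
  have hbudget : (B : ℝ) / τ - 1 ≤ 𝔼 X, (budgetLCS d (m + 1) B X : ℝ) := by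
    rcases lt_or_ge B d with hlt | hge
    · refine le_trans ?_ (expect_nonneg fun X _ => Nat.cast_nonneg _)
      rw [sub_nonpos, div_le_one hτ0]
      exact le_trans (by exact_mod_cast hlt.le) hdτ
    · rw [expect_prependOn univ]
      choose b hb using exists_card_filter_ne_eq (d := d)
      have hstep : ∀ x : Fin d → Fin 2, ((B - d : ℝ) - (d - |bias x|)) / τ ≤
          𝔼 X, (budgetLCS d (m + 1) B (prependOn univ x X) : ℝ) := by
        intro x
        have h := (ih (B - d) (by omega) (by omega)).1 {j | x j ≠ b x} (b x)
        rw [hb, Nat.cast_sub hge, mul_div_cancel₀ _ two_ne_zero] at h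
        refine h.trans (expect_le_expect fun X _ => ?_)
        have h1 := searchLCS_le_prependOn hd univ_nonempty (by simpa using hge) hB (b x) x X
        rw [card_univ, Fintype.card_fin] at h1
        exact_mod_cast h1.trans (searchLCS_univ_le hd _ _ _ _)
      refine le_trans ?_ (expect_le_expect fun x _ => hstep x)
      rw [← expect_div, expect_sub_distrib, Fintype.expect_const, expect_sub_distrib,
        Fintype.expect_const, div_sub_one hτ0.ne']
      rw [div_le_div_iff_of_pos_right hτ0]
      linarith [sqrt_le_expect_abs_bias hd]
  refine ⟨fun S b => ?_, hbudget⟩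
  rcases S.eq_empty_or_nonempty with rfl | hS
  · have h : 𝔼 X, ((budgetLCS d (m + 1) B X : ℝ) + 1) ≤
        𝔼 X, (searchLCS d (m + 1) B ∅ b X : ℝ) :=
      expect_le_expect fun X _ => by exact_mod_cast budgetLCS_add_one_le hd _ _ _ _
    rw [expect_add_distrib, Fintype.expect_const] at h
    simp only [card_empty, Nat.cast_zero, mul_zero, sub_zero]
    linarith
  · rcases lt_or_ge B #S with hlt | hge
    · refine le_trans ?_ (expect_nonneg fun X _ => Nat.cast_nonneg _)
      have : (B : ℝ) < #S := by exact_mod_cast hlt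
      exact div_nonpos_of_nonpos_of_nonneg (by linarith [Nat.cast_nonneg (α := ℝ) #S]) hτ0.le
    · rw [expect_prependOn S]
      have hpos := hS.card_pos
      have hstep : ∀ x : Fin d → Fin 2, ((B - #S : ℝ) - 2 * #{j ∈ S | x j ≠ b}) / τ ≤
          𝔼 X, (searchLCS d (m + 1) B S b (prependOn S x X) : ℝ) := by
        intro x
        have h := (ih (B - #S) (by omega) (by omega)).1 {j ∈ S | x j ≠ b} b
        rw [Nat.cast_sub hge] at h
        refine h.trans (expect_le_expect fun X _ => ?_)
        exact_mod_cast searchLCS_le_prependOn hd hS hge hB b x X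
      refine le_trans (le_of_eq ?_) (expect_le_expect fun x _ => hstep x)
      rw [← expect_div, expect_sub_distrib, ← mul_expect, expect_card_filter_ne,
        Fintype.expect_const]
      ring

theorem W_ge {d : ℕ} (hd : 0 < d) (m : ℕ) :
    (m + 1 : ℕ) / (2 * d - √d / 4) - 1 ≤ W d (m + 1) := by
  have h1 : √d ≤ d := by
    rw [Real.sqrt_le_left (Nat.cast_nonneg d)]
    have : (1 : ℝ) ≤ d := by exact_mod_cast hd
    nlinarith
  have h := (expect_searchLCS_and_budgetLCS_ge hd m (m + 1) le_rfl le_rfl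
    (by linarith [Real.sqrt_nonneg (d : ℝ)])).2
  rwa [Fintype.expect_eq_sum_div_card] at h

/-- There exists an absolute constant `c₁ > 0` such that for every `d ≥ 2` and all
sufficiently large `n`, the expected diagonal LCS satisfies
`W (n·d) ≥ n·(1/2 + c₁/√d)`. -/
theorem diagonal_lower_bound :
    ∃ c₁ : ℝ, 0 < c₁ ∧ ∀ d : ℕ, 2 ≤ d →
      ∀ᶠ n : ℕ in Filter.atTop,
        (n : ℝ) * (1 / 2 + c₁ / Real.sqrt d) ≤ W d (n * d) := by
  refine ⟨1 / 32, by norm_num, fun d hd => ?_⟩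
  filter_upwards [Filter.eventually_ge_atTop 1,
    tendsto_natCast_atTop_atTop.eventually_ge_atTop (32 * √(d : ℝ))] with n hn hn'
  obtain ⟨m, hm⟩ : ∃ m, n * d = m + 1 :=
    Nat.exists_eq_succ_of_ne_zero (Nat.mul_pos hn (by omega)).ne'
  have hW := W_ge (d := d) (by omega) m
  rw [← hm] at hW
  refine le_trans ?_ hW
  have hd1 : (1 : ℝ) ≤ d := by exact_mod_cast (by omega : 1 ≤ d)
  have hr1 : 1 ≤ √(d : ℝ) := Real.one_le_sqrt.2 hd1
  have hrd : (d : ℝ) = √d ^ 2 := (Real.sq_sqrt (Nat.cast_nonneg d)).symm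
  push_cast
  generalize √(d : ℝ) = r at *
  rw [hrd]
  have hr0 : 0 < r := by linarith
  have hden : 0 < 2 * r ^ 2 - r / 4 := by nlinarith
  have h1 : (n : ℝ) * (1 / 2 + 1 / (16 * r)) ≤ n * r ^ 2 / (2 * r ^ 2 - r / 4) := by
    rw [mul_div_assoc]
    gcongr
    rw [le_div_iff₀ hden]
    have : (1 / 2 + 1 / (16 * r)) * (2 * r ^ 2 - r / 4) = r ^ 2 - 1 / 64 := by
      field_simp
      ring
    linarith
  have h2 : 1 ≤ n / (32 * r) := by rwa [one_le_div (by positivity)]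
  have h3 : (n : ℝ) * (1 / 2 + 1 / 32 / r) = n * (1 / 2 + 1 / (16 * r)) - n / (32 * r) := by
    field_simp
    ring
  linarith
end

section
/- Let k ≥ 2, n ≥ 1, and 1 ≤ ℓ ≤ n be integers. For any string w of length ℓ over the alphabet [k], the number of strings of length n over [k] that contain w as a subsequence is at most Σ_{t=ℓ}^{n} binom(t−1, ℓ−1)·k^{n−t}·(k−1)^{t−ℓ}. -/
/-- The number of words of length `n` over `Fin k` having `w` as a subsequence. -/
noncomputable def supersequenceCard (k n : ℕ) (w : List (Fin k)) : ℕ :=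
  open Classical in
  (Finset.univ.filter (fun x : Fin n → Fin k => w.Sublist (List.ofFn x))).card

theorem supersequenceCard_nil (k n : ℕ) : supersequenceCard k n [] = k ^ n := by
  simp [supersequenceCard]

theorem supersequenceCard_zero_cons (k : ℕ) (a : Fin k) (w : List (Fin k)) :
    supersequenceCard k 0 (a :: w) = 0 := by
  simp [supersequenceCard]

theorem supersequenceCard_succ_cons (k n : ℕ) (a : Fin k) (w : List (Fin k)) :
    supersequenceCard k (n + 1) (a :: w) =
      supersequenceCard k n w + (k - 1) * supersequenceCard k n (a :: w) := by
  classical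
  have hsum : supersequenceCard k (n + 1) (a :: w) =
      ∑ b : Fin k, if b = a then supersequenceCard k n w
        else supersequenceCard k n (a :: w) := by
    unfold supersequenceCard
    rw [Finset.card_filter, ← (Fin.consEquiv (fun _ : Fin (n + 1) => Fin k)).sum_comp,
      Fintype.sum_prod_type]
    refine Finset.sum_congr rfl fun b _ => ?_
    split_ifs with hb
    · subst hb
      simp [Fin.consEquiv, List.ofFn_succ]
    · have hcons (y : List (Fin k)) : (a :: w).Sublist (b :: y) ↔ (a :: w).Sublist y := by
        refine ⟨fun h => ?_, fun h => h.cons b⟩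
        cases h with
        | cons _ h => exact h
        | cons_cons _ h => exact absurd rfl hb
      simp [Fin.consEquiv, List.ofFn_succ, hcons]
  rw [hsum, Fintype.sum_eq_add_sum_compl a, if_pos rfl]
  congr 1
  rw [Finset.sum_congr rfl (g := fun _ => supersequenceCard k n (a :: w))
    fun b hb => if_neg (by simpa using hb)]
  simp [Finset.card_compl]

theorem supersequenceCard_cons (k n : ℕ) (a : Fin k) (w : List (Fin k)) :
    supersequenceCard k n (a :: w) =
      ∑ t ∈ Finset.range n,
        t.choose w.length * k ^ (n - 1 - t) * (k - 1) ^ (t - w.length) := by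
  induction n generalizing a w with
  | zero => simp [supersequenceCard_zero_cons]
  | succ n ih =>
    rw [supersequenceCard_succ_cons, Finset.sum_range_succ', ih, Finset.mul_sum]
    have hexp (t : ℕ) : n + 1 - 1 - (t + 1) = n - 1 - t := by omega
    cases w with
    | nil =>
      rw [supersequenceCard_nil, add_comm]
      simp only [hexp, List.length_nil, Nat.choose_zero_right, Nat.sub_zero, pow_succ]
      simp
      exact Finset.sum_congr rfl fun t _ => by ring
    | cons b v =>
      rw [ih, ← Finset.sum_add_distrib]
      simp only [hexp, List.length_cons, Nat.choose_zero_succ, zero_mul, add_zero,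
        Nat.choose_succ_succ', Nat.add_sub_add_right]
      refine Finset.sum_congr rfl fun t _ => ?_
      rcases Nat.lt_or_ge t (v.length + 1) with h | h
      · simp [Nat.choose_eq_zero_of_lt h]
      · have hsub : t - v.length = t - (v.length + 1) + 1 := by omega
        rw [hsub, pow_succ]
        ring

open Classical in
/-- For any string `w` of length `ℓ` (with `1 ≤ ℓ ≤ n`) over an alphabet of size
`k ≥ 2`, the number of strings of length `n` containing `w` as a subsequence is at
most `∑_{t=ℓ}^{n} C(t−1, ℓ−1)·k^{n−t}·(k−1)^{t−ℓ}`. -/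
theorem supersequence_count (k n ℓ : ℕ) (hk : 2 ≤ k) (hn : 1 ≤ n)
    (hℓ : 1 ≤ ℓ) (hℓn : ℓ ≤ n) (w : List (Fin k)) (hw : w.length = ℓ) :
    (Finset.univ.filter (fun x : Fin n → Fin k => w.Sublist (List.ofFn x))).card
      ≤ ∑ t ∈ Finset.Icc ℓ n, (t - 1).choose (ℓ - 1) * k ^ (n - t) * (k - 1) ^ (t - ℓ) := by
  cases w with
  | nil => simp at hw; omega
  | cons a v =>
    subst hw
    refine (supersequenceCard_cons k n a v).le.trans ?_
    rw [← Finset.sum_subset (s₁ := Finset.Ico v.length n)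
      (fun t ht => by simp at ht ⊢; omega)
      (fun t ht hv => by
        rw [Nat.choose_eq_zero_of_lt (by simp at ht hv; omega)]; simp)]
    have hIcc : Finset.Icc (v.length + 1) n = Finset.Ico (v.length + 1) (n + 1) := by
      ext t; simp
    rw [List.length_cons, hIcc, ← Finset.sum_Ico_add']
    refine (Finset.sum_congr rfl fun t _ => ?_).le
    simp [Nat.sub_sub, add_comm 1 t]
end
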